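/- For any symmetric memoryless channel of capacity C and any binary linear code of rate R < C, there exist Ω(n) coordinates j such that P_loc,j ≤ 1/2 − Ω(1), where P_loc,j is the error probability of ML decoding of X_j from the outputs at all other coordinates. -/

import Mathlib

open Finset

/-- Probability of a single noise symbol `(e, b)` under the symmetric-channel mixture with
mixing weights `q` and crossover probabilities `eps`: the channel outputs
`Y_i = (ε_i, X_i + w_i)` with `w_i ~ Ber(eps ε_i)`. -/
noncomputable def noiseP {E : Type*} (q eps : E → ℝ) (z : E × ZMod 2) : ℝ :=
  q z.1 * (if z.2 = 1 then eps z.1 else 1 - eps z.1)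

/-- Binary entropy (base 2). -/
noncomputable def binEnt (p : ℝ) : ℝ :=
  -(p * Real.logb 2 p) - ((1 - p) * Real.logb 2 (1 - p))

/-- Capacity of the symmetric channel that is the mixture of the `BSC(eps e)`
with weights `q e`. -/
noncomputable def capacity {E : Type*} [Fintype E] (q eps : E → ℝ) : ℝ :=
  ∑ e, q e * (1 - binEnt (eps e))

open Classical in
/-- Joint probability of a (codeword, noise) pair: the codeword is uniform on the linear
code `C`, the noise is i.i.d. across coordinates. -/
noncomputable def jointP {ι E : Type*} [Fintype ι] [Fintype E]
    (C : Submodule (ZMod 2) (ι → ZMod 2)) (q eps : E → ℝ)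
    (ω : ↥C × (ι → E × ZMod 2)) : ℝ :=
  (Nat.card C : ℝ)⁻¹ * ∏ i, noiseP q eps (ω.2 i)

/-- Channel output on input codeword `x` and noise realization `z`. -/
def outputOf {ι E : Type*} (x : ι → ZMod 2) (z : ι → E × ZMod 2) : ι → E × ZMod 2 :=
  fun i => ((z i).1, x i + (z i).2)

open Classical in
/-- Posterior weight of the event `X_i = b` and the outputs on `S` agree with `y`. -/
noncomputable def post {ι E : Type*} [Fintype ι] [Fintype E]
    (C : Submodule (ZMod 2) (ι → ZMod 2)) (q eps : E → ℝ) (i : ι) (S : Finset ι)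
    (b : ZMod 2) (y : ι → E × ZMod 2) : ℝ :=
  ∑ ω : ↥C × (ι → E × ZMod 2),
    if (ω.1 : ι → ZMod 2) i = b ∧ ∀ j ∈ S, outputOf (ω.1 : ι → ZMod 2) ω.2 j = y j
    then jointP C q eps ω else 0

open Classical in
/-- ML (MAP) decoding of bit `i` from the outputs on `S`. -/
noncomputable def decodeBit {ι E : Type*} [Fintype ι] [Fintype E]
    (C : Submodule (ZMod 2) (ι → ZMod 2)) (q eps : E → ℝ) (i : ι) (S : Finset ι)
    (y : ι → E × ZMod 2) : ZMod 2 :=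
  if post C q eps i S 1 y > post C q eps i S 0 y then 1 else 0

open Classical in
/-- Probability that ML decoding of bit `i` from the outputs on `S` is wrong. -/
noncomputable def errP {ι E : Type*} [Fintype ι] [Fintype E]
    (C : Submodule (ZMod 2) (ι → ZMod 2)) (q eps : E → ℝ) (i : ι) (S : Finset ι) : ℝ :=
  ∑ ω : ↥C × (ι → E × ZMod 2),
    if decodeBit C q eps i S (outputOf (ω.1 : ι → ZMod 2) ω.2) ≠ (ω.1 : ι → ZMod 2) i
    then jointP C q eps ω else 0

/-- `P_loc,i` : error probability of ML decoding of `X_i` from all other outputs. -/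
noncomputable def Ploc {ι E : Type*} [Fintype ι] [DecidableEq ι] [Fintype E]
    (C : Submodule (ZMod 2) (ι → ZMod 2)) (q eps : E → ℝ) (i : ι) : ℝ :=
  errP C q eps i (Finset.univ.erase i)

/-- `P_bit,i` : error probability of ML decoding of `X_i` from the full output. -/
noncomputable def Pbit {ι E : Type*} [Fintype ι] [Fintype E]
    (C : Submodule (ZMod 2) (ι → ZMod 2)) (q eps : E → ℝ) (i : ι) : ℝ :=
  errP C q eps i Finset.univ

/-- Rate of a linear code. -/
noncomputable def rate {ι : Type*} [Fintype ι] (C : Submodule (ZMod 2) (ι → ZMod 2)) : ℝ :=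
  (Module.finrank (ZMod 2) ↥C : ℝ) / (Fintype.card ι)

/-- Validity of the symmetric-channel parameters: `q` is a probability vector and each
crossover probability lies in `[0, 1/2]`. -/
def ChannelValid {E : Type*} [Fintype E] (q eps : E → ℝ) : Prop :=
  (∀ e, 0 ≤ q e) ∧ (∑ e, q e = 1) ∧ (∀ e, 0 ≤ eps e ∧ eps e ≤ 1 / 2)

section LocalDecoding

open scoped Classical

/-! ### Likelihood ratios and bit flips -/

variable {ι E : Type*}

lemma zmod_two_cases (b : ZMod 2) : b = 0 ∨ b = 1 := by
  revert b; decide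

lemma zmod_two_one_add_one : (1 : ZMod 2) + 1 = 0 := by decide

/-- Ratio of the law of a noise symbol to the law `q × uniform`. -/
noncomputable def symbolRatio (eps : E → ℝ) (z : E × ZMod 2) : ℝ :=
  2 * (if z.2 = 1 then eps z.1 else 1 - eps z.1)

/-- Likelihood ratio of the outputs on `S` given the codeword `x`. -/
noncomputable def likRatio (eps : E → ℝ) (S : Finset ι) (x : ι → ZMod 2)
    (y : ι → E × ZMod 2) : ℝ :=
  ∏ i ∈ S, symbolRatio eps ((y i).1, (y i).2 + x i)

/-- Flip the output bit at coordinate `k`. -/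
noncomputable def flipBit (k : ι) (y : ι → E × ZMod 2) : ι → E × ZMod 2 :=
  Function.update y k ((y k).1, (y k).2 + 1)

/-- The sign `(-1) ^ (x k)`. -/
noncomputable def bitSign (k : ι) (x : ι → ZMod 2) : ℝ := if x k = 0 then 1 else -1

lemma symbolRatio_add_flip (eps : E → ℝ) (e : E) (b : ZMod 2) :
    symbolRatio eps (e, b) + symbolRatio eps (e, b + 1) = 2 := by
  rcases zmod_two_cases b with rfl | rfl <;> simp [symbolRatio, zmod_two_one_add_one] <;> ring

lemma noiseP_eq (q eps : E → ℝ) (z : E × ZMod 2) :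
    noiseP q eps z = q z.1 / 2 * symbolRatio eps z := by
  unfold noiseP symbolRatio; ring

lemma symbolRatio_nonneg [Fintype E] {q eps : E → ℝ} (h : ChannelValid q eps) (z : E × ZMod 2) :
    0 ≤ symbolRatio eps z := by
  have := h.2.2 z.1
  unfold symbolRatio
  split_ifs <;> linarith

lemma likRatio_nonneg [Fintype E] {q eps : E → ℝ} (h : ChannelValid q eps) (S : Finset ι)
    (x : ι → ZMod 2) (y : ι → E × ZMod 2) : 0 ≤ likRatio eps S x y :=
  prod_nonneg fun _ _ => symbolRatio_nonneg h _

lemma flipBit_flipBit (k : ι) (y : ι → E × ZMod 2) : flipBit k (flipBit k y) = y := by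
  funext i
  by_cases hi : i = k
  · subst hi
    simp [flipBit, add_assoc, zmod_two_one_add_one]
  · simp [flipBit, hi]

lemma flipBit_fst (k i : ι) (y : ι → E × ZMod 2) : (flipBit k y i).1 = (y i).1 := by
  by_cases hi : i = k
  · subst hi; simp [flipBit]
  · simp [flipBit, hi]

lemma likRatio_flip {S : Finset ι} {k : ι} (hk : k ∉ S) (eps : E → ℝ) (x : ι → ZMod 2)
    (y : ι → E × ZMod 2) : likRatio eps S x (flipBit k y) = likRatio eps S x y := by
  refine prod_congr rfl fun i hi => ?_
  have : i ≠ k := fun h => hk (h ▸ hi)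
  simp [flipBit, this]

lemma likRatio_insert {S : Finset ι} {k : ι} (hk : k ∉ S) (eps : E → ℝ) (x : ι → ZMod 2)
    (y : ι → E × ZMod 2) :
    likRatio eps (insert k S) x y =
      symbolRatio eps ((y k).1, (y k).2 + x k) * likRatio eps S x y :=
  prod_insert hk

lemma likRatio_insert_flip {S : Finset ι} {k : ι} (hk : k ∉ S) (eps : E → ℝ)
    (x : ι → ZMod 2) (y : ι → E × ZMod 2) :
    likRatio eps (insert k S) x (flipBit k y) =
      symbolRatio eps ((y k).1, (y k).2 + x k + 1) * likRatio eps S x y := by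
  rw [likRatio_insert hk, likRatio_flip hk]
  simp [flipBit, add_right_comm]

lemma likRatio_insert_add_flip {S : Finset ι} {k : ι} (hk : k ∉ S) (eps : E → ℝ)
    (x : ι → ZMod 2) (y : ι → E × ZMod 2) :
    likRatio eps (insert k S) x y + likRatio eps (insert k S) x (flipBit k y) =
      2 * likRatio eps S x y := by
  rw [likRatio_insert hk, likRatio_insert_flip hk, ← add_mul, symbolRatio_add_flip]

lemma mul_logb_two_mul (a : ℝ) :
    2 * a * Real.logb 2 (2 * a) = 2 * (a + a * Real.logb 2 a) := by
  rcases eq_or_ne a 0 with rfl | ha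
  · simp
  · rw [Real.logb_mul two_ne_zero ha, Real.logb_self_eq_one one_lt_two]
    ring

lemma mul_mul_logb_mul (a b : ℝ) :
    a * b * Real.logb 2 (a * b) = b * (a * Real.logb 2 a) + a * (b * Real.logb 2 b) := by
  rcases eq_or_ne a 0 with rfl | ha
  · simp
  rcases eq_or_ne b 0 with rfl | hb
  · simp
  rw [Real.logb_mul ha hb]
  ring

lemma symbolRatio_mul_logb_add_flip (eps : E → ℝ) (e : E) (b : ZMod 2) :
    symbolRatio eps (e, b) * Real.logb 2 (symbolRatio eps (e, b)) +
      symbolRatio eps (e, b + 1) * Real.logb 2 (symbolRatio eps (e, b + 1)) =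
      2 * (1 - binEnt (eps e)) := by
  rcases zmod_two_cases b with rfl | rfl <;>
    simp [symbolRatio, zmod_two_one_add_one, mul_logb_two_mul, binEnt] <;> ring

lemma mul_logb_add_mul_logb_le {u v : ℝ} (hu : 0 ≤ u) (hv : 0 ≤ v) :
    u * Real.logb 2 u + v * Real.logb 2 v ≤
      2 * ((u + v) / 2 * Real.logb 2 ((u + v) / 2)) + |u - v| := by
  wlog huv : v ≤ u generalizing u v
  · have := this hv hu (le_of_not_ge huv)
    rw [abs_sub_comm, add_comm v u] at this
    linarith
  rcases hu.eq_or_lt with rfl | hu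
  · obtain rfl : v = 0 := le_antisymm huv hv
    simp
  rw [abs_of_nonneg (sub_nonneg.2 huv)]
  set m := (u + v) / 2 with hm
  have hm0 : 0 < m := by rw [hm]; positivity
  set t := (u - v) / (u + v) with ht
  have ht0 : 0 ≤ t := div_nonneg (sub_nonneg.2 huv) (by positivity)
  have ht1 : t ≤ 1 := (div_le_one (by positivity)).2 (by linarith)
  have htm : 2 * (t * m) = u - v := by rw [ht, hm]; field_simp
  have hu' : u = (1 - t) * m + t * (2 * m) := by linarith
  have hv' : v = (1 - t) * m + t * 0 := by linarith
  have hl2 : 0 < Real.log 2 := Real.log_pos one_lt_two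
  have hcu := Real.convexOn_mul_log.2 (Set.mem_Ici.2 hm0.le)
    (Set.mem_Ici.2 (by positivity : 0 ≤ 2 * m)) (sub_nonneg.2 ht1) ht0 (by ring)
  have hcv := Real.convexOn_mul_log.2 (Set.mem_Ici.2 hm0.le)
    (Set.mem_Ici.2 le_rfl) (sub_nonneg.2 ht1) ht0 (by ring)
  simp only [smul_eq_mul] at hcu hcv
  rw [← hu', Real.log_mul two_ne_zero hm0.ne'] at hcu
  rw [← hv'] at hcv
  have key : u * Real.log u + v * Real.log v ≤
      (2 * (m * (Real.log m / Real.log 2)) + (u - v)) * Real.log 2 := by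
    have : (2 * (m * (Real.log m / Real.log 2)) + (u - v)) * Real.log 2 =
        2 * (m * Real.log m) + (u - v) * Real.log 2 := by field_simp
    rw [this, ← htm]
    linarith
  simp only [Real.logb]
  rw [← mul_div_assoc, ← mul_div_assoc, ← add_div, div_le_iff₀ hl2]
  exact key

lemma outputOf_outputOf (x : ι → ZMod 2) (y : ι → E × ZMod 2) :
    outputOf x (outputOf x y) = y := by
  funext i
  have : x i + x i = 0 := by rcases zmod_two_cases (x i) with h | h <;> rw [h] <;> decide
  simp [outputOf, ← add_assoc, this]

lemma prod_noiseP_outputOf (q eps : E → ℝ) (S : Finset ι) (x : ι → ZMod 2)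
    (y : ι → E × ZMod 2) :
    ∏ i ∈ S, noiseP q eps (outputOf x y i) =
      (∏ i ∈ S, q (y i).1 / 2) * likRatio eps S x y := by
  rw [likRatio, ← prod_mul_distrib]
  exact prod_congr rfl fun i _ => by rw [noiseP_eq, outputOf, add_comm]

/-! ### Expectation under the reference measure -/

section RefExp

variable [Fintype E]

lemma sum_symbol_div_two (q g : E → ℝ) :
    ∑ z : E × ZMod 2, q z.1 / 2 * g z.1 = ∑ e, q e * g e := by
  rw [Fintype.sum_prod_type]
  refine sum_congr rfl fun e _ => ?_
  simp [sum_const, ZMod.card]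
  ring

lemma sum_noiseP {q eps : E → ℝ} (h : ChannelValid q eps) : ∑ z, noiseP q eps z = 1 := by
  rw [Fintype.sum_prod_type, ← h.2.1]
  refine sum_congr rfl fun e _ => ?_
  rw [show (univ : Finset (ZMod 2)) = {0, 1} from rfl, sum_pair zero_ne_one]
  simp [noiseP]
  ring

variable [Fintype ι]

/-- Expectation with respect to the product of the laws `q × uniform`. -/
noncomputable def refExp (q : E → ℝ) (f : (ι → E × ZMod 2) → ℝ) : ℝ :=
  ∑ y, (∏ i, q (y i).1 / 2) * f y

lemma refExp_flip (q : E → ℝ) (k : ι) (f : (ι → E × ZMod 2) → ℝ) :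
    refExp q (fun y => f (flipBit k y)) = refExp q f := by
  unfold refExp
  refine Fintype.sum_equiv (Function.Involutive.toPerm (flipBit k) (flipBit_flipBit k)) _ _
    fun y => ?_
  change _ = (∏ i, q (flipBit k y i).1 / 2) * f (flipBit k y)
  simp only [flipBit_fst]

lemma refExp_add (q : E → ℝ) (f g : (ι → E × ZMod 2) → ℝ) :
    refExp q (fun y => f y + g y) = refExp q f + refExp q g := by
  simp [refExp, mul_add, sum_add_distrib]

lemma refExp_const_mul (q : E → ℝ) (c : ℝ) (f : (ι → E × ZMod 2) → ℝ) :
    refExp q (fun y => c * f y) = c * refExp q f := by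
  simp only [refExp, mul_sum]
  exact sum_congr rfl fun _ _ => by ring

lemma refExp_sum {κ : Type*} (s : Finset κ) (q : E → ℝ) (f : κ → (ι → E × ZMod 2) → ℝ) :
    refExp q (fun y => ∑ a ∈ s, f a y) = ∑ a ∈ s, refExp q (f a) := by
  simp only [refExp, mul_sum]
  exact sum_comm

lemma refExp_mono {q eps : E → ℝ} (h : ChannelValid q eps) {f g : (ι → E × ZMod 2) → ℝ}
    (hfg : ∀ y, f y ≤ g y) : refExp q f ≤ refExp q g :=
  sum_le_sum fun y _ => mul_le_mul_of_nonneg_left (hfg y)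
    (prod_nonneg fun _ _ => div_nonneg (h.1 _) zero_le_two)

/-- Averaging a function with its flip does not change the expectation. -/
lemma refExp_add_flip (q : E → ℝ) (k : ι) (f : (ι → E × ZMod 2) → ℝ) :
    refExp q (fun y => f y + f (flipBit k y)) = 2 * refExp q f := by
  rw [refExp_add, refExp_flip, two_mul]

lemma refExp_fst {q eps : E → ℝ} (h : ChannelValid q eps) (k : ι) (g : E → ℝ) :
    refExp q (fun y : ι → E × ZMod 2 => g (y k).1) = ∑ e, q e * g e := by
  have hprod : ∀ y : ι → E × ZMod 2, (∏ i, q (y i).1 / 2) * g (y k).1 =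
      ∏ i, (q (y i).1 / 2 * if i = k then g (y i).1 else 1) := by
    intro y
    rw [prod_mul_distrib, prod_ite_eq' univ k fun i => g (y i).1]
    simp
  unfold refExp
  simp_rw [hprod]
  rw [← Fintype.prod_sum fun i (z : E × ZMod 2) => q z.1 / 2 * if i = k then g z.1 else 1,
    Fintype.prod_eq_single k]
  · simpa using sum_symbol_div_two q g
  · intro i hi
    have := sum_symbol_div_two q fun _ => 1
    simpa [hi, h.2.1] using this

lemma refExp_one {q eps : E → ℝ} (h : ChannelValid q eps) :
    refExp q (fun _ : ι → E × ZMod 2 => 1) = 1 := by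
  unfold refExp
  simp_rw [mul_one]
  rw [← Fintype.prod_sum fun (_ : ι) (z : E × ZMod 2) => q z.1 / 2]
  have := sum_symbol_div_two q fun _ => 1
  simp only [mul_one, h.2.1] at this
  simp [this]

/-- The likelihood ratio on `S` integrates out against functions that ignore the bits on `S`. -/
lemma refExp_likRatio_mul (q eps : E → ℝ) (S : Finset ι) (x : ι → ZMod 2)
    (g : (ι → E × ZMod 2) → ℝ) (hg : ∀ k ∈ S, ∀ y, g (flipBit k y) = g y) :
    refExp q (fun y => likRatio eps S x y * g y) = refExp q g := by
  induction S using Finset.induction_on with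
  | empty => simp [likRatio]
  | insert k S hk ih =>
    rw [← ih fun j hj => hg j (mem_insert_of_mem hj)]
    have := refExp_add_flip q k fun y => likRatio eps (insert k S) x y * g y
    simp_rw [hg k (mem_insert_self k S), ← add_mul, likRatio_insert_add_flip hk,
      mul_assoc, refExp_const_mul] at this
    linarith

lemma refExp_likRatio {q eps : E → ℝ} (h : ChannelValid q eps) (S : Finset ι)
    (x : ι → ZMod 2) : refExp q (likRatio eps S x) = 1 := by
  simpa [refExp_one h] using refExp_likRatio_mul q eps S x (fun _ => 1) (by simp)

/-- The divergence of the output law given a codeword is the sum of the capacities. -/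
lemma refExp_likRatio_mul_logb {q eps : E → ℝ} (h : ChannelValid q eps) (S : Finset ι)
    (x : ι → ZMod 2) :
    refExp q (fun y => likRatio eps S x y * Real.logb 2 (likRatio eps S x y)) =
      #S * capacity q eps := by
  induction S using Finset.induction_on with
  | empty => simp [likRatio, refExp]
  | insert k S hk ih =>
    have hflip := refExp_add_flip q k fun y =>
      likRatio eps (insert k S) x y * Real.logb 2 (likRatio eps (insert k S) x y)
    have hpt : ∀ y : ι → E × ZMod 2,
        likRatio eps (insert k S) x y * Real.logb 2 (likRatio eps (insert k S) x y) +
          likRatio eps (insert k S) x (flipBit k y) *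
            Real.logb 2 (likRatio eps (insert k S) x (flipBit k y)) =
        2 * (likRatio eps S x y * (1 - binEnt (eps (y k).1))) +
          2 * (likRatio eps S x y * Real.logb 2 (likRatio eps S x y)) := fun y => by
      rw [likRatio_insert hk, likRatio_insert_flip hk, mul_mul_logb_mul, mul_mul_logb_mul]
      linear_combination
        likRatio eps S x y * symbolRatio_mul_logb_add_flip eps (y k).1 ((y k).2 + x k) +
        likRatio eps S x y * Real.logb 2 (likRatio eps S x y) *
          symbolRatio_add_flip eps (y k).1 ((y k).2 + x k)
    simp_rw [hpt] at hflip
    rw [refExp_add, refExp_const_mul, refExp_const_mul, ih,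
      refExp_likRatio_mul q eps S x _ fun j _ y => by rw [flipBit_fst],
      refExp_fst h k fun e => 1 - binEnt (eps e)] at hflip
    rw [card_insert_of_notMem hk]
    push_cast
    unfold capacity at *
    linarith

end RefExp

/-! ### Mixtures over the code -/

variable [Fintype ι] (C : Submodule (ZMod 2) (ι → ZMod 2))

/-- Average over the code of the likelihood ratios on `S`, weighted by `w`. -/
noncomputable def codeMix (eps : E → ℝ)
    (w : (ι → ZMod 2) → ℝ) (S : Finset ι) (y : ι → E × ZMod 2) : ℝ :=
  (Nat.card C : ℝ)⁻¹ * ∑ x : C, w x * likRatio eps S x y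

lemma codeMix_insert_add_flip {S : Finset ι} {k : ι} (hk : k ∉ S) (eps : E → ℝ)
    (w : (ι → ZMod 2) → ℝ) (y : ι → E × ZMod 2) :
    codeMix C eps w (insert k S) y + codeMix C eps w (insert k S) (flipBit k y) =
      2 * codeMix C eps w S y := by
  simp only [codeMix]
  rw [← mul_add, ← sum_add_distrib]
  simp_rw [← mul_add, likRatio_insert_add_flip hk, mul_left_comm _ (2 : ℝ)]
  rw [← mul_sum]
  ring

lemma codeMix_insert_sub_flip {S : Finset ι} {k : ι} (hk : k ∉ S) (eps : E → ℝ)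
    (y : ι → E × ZMod 2) :
    codeMix C eps 1 (insert k S) y - codeMix C eps 1 (insert k S) (flipBit k y) =
      (symbolRatio eps ((y k).1, (y k).2) - symbolRatio eps ((y k).1, (y k).2 + 1)) *
        codeMix C eps (bitSign k) S y := by
  simp only [codeMix]
  rw [← mul_sub, ← sum_sub_distrib, mul_left_comm]
  congr 1
  rw [mul_sum]
  refine sum_congr rfl fun x _ => ?_
  rw [likRatio_insert hk, likRatio_insert_flip hk]
  rcases zmod_two_cases ((x : ι → ZMod 2) k) with h | h <;>
    simp [h, bitSign, add_assoc, zmod_two_one_add_one] <;> ring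

lemma codeMix_eq_zero (eps : E → ℝ) (k : ι) (S : Finset ι) (y : ι → E × ZMod 2) :
    codeMix C eps (fun x => if x k = 0 then 1 else 0) S y =
      (codeMix C eps 1 S y + codeMix C eps (bitSign k) S y) / 2 := by
  unfold codeMix
  rw [← mul_add, ← sum_add_distrib, mul_div_assoc, sum_div]
  congr 1
  refine sum_congr rfl fun x _ => ?_
  simp only [bitSign, Pi.one_apply]
  split_ifs <;> ring

lemma codeMix_eq_one (eps : E → ℝ) (k : ι) (S : Finset ι) (y : ι → E × ZMod 2) :
    codeMix C eps (fun x => if x k = 1 then 1 else 0) S y =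
      (codeMix C eps 1 S y - codeMix C eps (bitSign k) S y) / 2 := by
  unfold codeMix
  rw [← mul_sub, ← sum_sub_distrib, mul_div_assoc, sum_div]
  congr 1
  refine sum_congr rfl fun x _ => ?_
  rcases zmod_two_cases ((x : ι → ZMod 2) k) with hx | hx <;> simp [bitSign, hx]

variable [Fintype E]

lemma codeMix_one_nonneg {q eps : E → ℝ} (h : ChannelValid q eps) (S : Finset ι)
    (y : ι → E × ZMod 2) : 0 ≤ codeMix C eps 1 S y :=
  mul_nonneg (by positivity) (sum_nonneg fun x _ => by
    simpa using likRatio_nonneg h S (x : ι → ZMod 2) y)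

lemma abs_codeMix_insert_sub_flip_le {q eps : E → ℝ} (h : ChannelValid q eps)
    {S : Finset ι} {k : ι} (hk : k ∉ S) (y : ι → E × ZMod 2) :
    |codeMix C eps 1 (insert k S) y - codeMix C eps 1 (insert k S) (flipBit k y)| ≤
      2 * |codeMix C eps (bitSign k) S y| := by
  rw [codeMix_insert_sub_flip C hk, abs_mul]
  refine mul_le_mul_of_nonneg_right ?_ (abs_nonneg _)
  have h1 := symbolRatio_nonneg h ((y k).1, (y k).2)
  have h2 := symbolRatio_nonneg h ((y k).1, (y k).2 + 1)
  have h3 := symbolRatio_add_flip eps (y k).1 (y k).2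
  exact abs_le.2 ⟨by linarith, by linarith⟩

/-- Observing more outputs increases the advantage in guessing the bit `k`. -/
lemma refExp_abs_codeMix_mono {q eps : E → ℝ} (h : ChannelValid q eps)
    (w : (ι → ZMod 2) → ℝ) {S T : Finset ι} (hST : S ⊆ T) :
    refExp q (fun y => |codeMix C eps w S y|) ≤ refExp q (fun y => |codeMix C eps w T y|) := by
  refine monotone_iff_forall_le_insert
    (f := fun S => refExp q fun y => |codeMix C eps w S y|).2 (fun S k hk => ?_) hST
  have hflip := refExp_add_flip q k fun y => |codeMix C eps w (insert k S) y|
  have hpt : ∀ y : ι → E × ZMod 2, 2 * |codeMix C eps w S y| ≤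
      |codeMix C eps w (insert k S) y| + |codeMix C eps w (insert k S) (flipBit k y)| := by
    intro y
    have := abs_add_le (codeMix C eps w (insert k S) y)
      (codeMix C eps w (insert k S) (flipBit k y))
    rwa [codeMix_insert_add_flip C hk, abs_mul, abs_two] at this
  have hle := refExp_mono h hpt
  rw [hflip, refExp_const_mul] at hle
  linarith

/-- Divergence of the output law on `S` from the reference law. -/
noncomputable def outputDiv (q eps : E → ℝ) (S : Finset ι) : ℝ :=
  refExp q fun y => codeMix C eps 1 S y * Real.logb 2 (codeMix C eps 1 S y)

lemma outputDiv_insert_le {q eps : E → ℝ} (h : ChannelValid q eps) {S : Finset ι} {k : ι}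
    (hk : k ∉ S) :
    outputDiv C q eps (insert k S) ≤
      outputDiv C q eps S + refExp q fun y => |codeMix C eps (bitSign k) S y| := by
  have hflip := refExp_add_flip q k fun y =>
    codeMix C eps 1 (insert k S) y * Real.logb 2 (codeMix C eps 1 (insert k S) y)
  have hpt : ∀ y : ι → E × ZMod 2,
      codeMix C eps 1 (insert k S) y * Real.logb 2 (codeMix C eps 1 (insert k S) y) +
        codeMix C eps 1 (insert k S) (flipBit k y) *
          Real.logb 2 (codeMix C eps 1 (insert k S) (flipBit k y)) ≤
      2 * (codeMix C eps 1 S y * Real.logb 2 (codeMix C eps 1 S y)) +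
        2 * |codeMix C eps (bitSign k) S y| := by
    intro y
    have hφ := mul_logb_add_mul_logb_le (codeMix_one_nonneg C h (insert k S) y)
      (codeMix_one_nonneg C h (insert k S) (flipBit k y))
    rw [codeMix_insert_add_flip C hk, mul_div_cancel_left₀ _ (two_ne_zero' ℝ)] at hφ
    exact hφ.trans (add_le_add_right (abs_codeMix_insert_sub_flip_le C h hk y) _)
  have hle := refExp_mono h hpt
  rw [hflip, refExp_add, refExp_const_mul, refExp_const_mul] at hle
  unfold outputDiv
  linarith

lemma outputDiv_empty (q eps : E → ℝ) : outputDiv C q eps ∅ = 0 := by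
  have : ∀ y, codeMix C eps 1 ∅ y = 1 := fun y => by
    simp [codeMix, likRatio]
  simp [outputDiv, this, refExp]

lemma outputDiv_le {q eps : E → ℝ} (h : ChannelValid q eps) (S : Finset ι) :
    outputDiv C q eps S ≤
      ∑ k ∈ S, refExp q fun y => |codeMix C eps (bitSign k) (univ.erase k) y| := by
  induction S using Finset.induction_on with
  | empty => simp [outputDiv_empty]
  | insert k S hk ih =>
    rw [sum_insert hk]
    have h1 := outputDiv_insert_le C h hk
    have h2 := refExp_abs_codeMix_mono C h (bitSign k)
      (fun i hi => mem_erase.2 ⟨fun hik => hk (hik ▸ hi), mem_univ i⟩ : S ⊆ univ.erase k)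
    linarith

lemma le_outputDiv_univ {q eps : E → ℝ} (h : ChannelValid q eps) :
    Fintype.card ι * capacity q eps - Real.logb 2 (Nat.card C) ≤ outputDiv C q eps univ := by
  have hc : (0 : ℝ) < Nat.card C := by exact_mod_cast Nat.card_pos
  have hpt : ∀ y : ι → E × ZMod 2,
      (Nat.card C : ℝ)⁻¹ * ∑ x : C,
        (likRatio eps univ x y * Real.logb 2 (likRatio eps univ x y) +
          -Real.logb 2 (Nat.card C) * likRatio eps univ x y) ≤
      codeMix C eps 1 univ y * Real.logb 2 (codeMix C eps 1 univ y) := fun y => by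
    have hexp : codeMix C eps 1 univ y * Real.logb 2 (codeMix C eps 1 univ y) =
        (Nat.card C : ℝ)⁻¹ * ∑ x : C,
          likRatio eps univ x y * Real.logb 2 (codeMix C eps 1 univ y) := by
      rw [← sum_mul, ← mul_assoc]
      simp [codeMix]
    rw [hexp]
    refine mul_le_mul_of_nonneg_left (sum_le_sum fun x _ => ?_) (by positivity)
    have h0 := likRatio_nonneg h univ (x : ι → ZMod 2) y
    rcases h0.eq_or_lt with h0 | h0
    · simp [← h0]
    have hle : (Nat.card C : ℝ)⁻¹ * likRatio eps univ x y ≤ codeMix C eps 1 univ y := by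
      refine mul_le_mul_of_nonneg_left ?_ (by positivity)
      simpa using single_le_sum
        (f := fun x : C => likRatio eps univ (x : ι → ZMod 2) y)
        (fun x _ => likRatio_nonneg h univ (x : ι → ZMod 2) y) (mem_univ x)
    have hlog := Real.logb_le_logb_of_le one_lt_two (by positivity) hle
    rw [Real.logb_mul (by positivity) h0.ne', Real.logb_inv] at hlog
    have := mul_le_mul_of_nonneg_left hlog h0.le
    linarith
  refine le_trans (le_of_eq ?_) (refExp_mono h hpt)
  rw [refExp_const_mul, refExp_sum]
  simp_rw [refExp_add, refExp_const_mul, refExp_likRatio_mul_logb h]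
  simp_rw [show ∀ x : C, refExp q (fun y => likRatio eps univ (x : ι → ZMod 2) y) = 1 from
    fun x => refExp_likRatio h univ _]
  rw [sum_const, card_univ, ← Nat.card_eq_fintype_card (α := C), nsmul_eq_mul, ← mul_assoc,
    inv_mul_cancel₀ hc.ne', card_univ]
  ring

/-! ### The local decoding error -/

lemma sum_outputOf (x : ι → ZMod 2) (f : (ι → E × ZMod 2) → ℝ) :
    ∑ y, f (outputOf x y) = ∑ z, f z :=
  Fintype.sum_equiv (Function.Involutive.toPerm (outputOf x) (outputOf_outputOf x)) _ _
    fun _ => rfl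

/-- Probability that the outputs on `S` agree with `y` when `x` is sent. -/
lemma sum_prod_noiseP_of_agree {q eps : E → ℝ} (h : ChannelValid q eps) (S : Finset ι)
    (x : ι → ZMod 2) (y : ι → E × ZMod 2) :
    ∑ z : ι → E × ZMod 2,
      (if ∀ j ∈ S, outputOf x z j = y j then ∏ i, noiseP q eps (z i) else 0) =
      (∏ i ∈ S, q (y i).1 / 2) * likRatio eps S x y := by
  have hsolve : ∀ z : ι → E × ZMod 2, ∀ j, outputOf x z j = y j ↔ z j = outputOf x y j := by
    intro z j
    have hz := congrFun (outputOf_outputOf x z) j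
    have hy := congrFun (outputOf_outputOf x y) j
    simp only [outputOf] at *
    exact ⟨fun hzy => by rw [← hz, ← hzy], fun hzy => by rw [← hy, hzy]⟩
  have hprod : ∀ z : ι → E × ZMod 2,
      (if ∀ j ∈ S, outputOf x z j = y j then ∏ i, noiseP q eps (z i) else 0) =
      ∏ i, if i ∈ S → z i = outputOf x y i then noiseP q eps (z i) else 0 := by
    intro z
    simp_rw [hsolve]
    rw [prod_ite_zero]
    simp
  simp_rw [hprod]
  rw [← Fintype.prod_sum fun i (z : E × ZMod 2) =>
      if i ∈ S → z = outputOf x y i then noiseP q eps z else 0,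
    ← prod_noiseP_outputOf, ← prod_subset (subset_univ S)]
  · exact prod_congr rfl fun i hi => by simp [hi]
  · intro i _ hi
    simpa [hi] using sum_noiseP h

lemma post_eq {q eps : E → ℝ} (h : ChannelValid q eps) (k : ι) (S : Finset ι) (b : ZMod 2)
    (y : ι → E × ZMod 2) :
    post C q eps k S b y =
      (∏ i ∈ S, q (y i).1 / 2) * codeMix C eps (fun x => if x k = b then 1 else 0) S y := by
  unfold post codeMix jointP
  rw [Fintype.sum_prod_type, mul_left_comm, mul_sum, mul_sum]
  refine sum_congr rfl fun x _ => ?_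
  by_cases hx : (x : ι → ZMod 2) k = b
  · simp only [hx, true_and, if_true, one_mul]
    rw [← sum_prod_noiseP_of_agree h, mul_sum]
    exact sum_congr rfl fun z _ => by simp only [mul_ite, mul_zero]
  · simp [hx]

lemma refExp_codeMix_one {q eps : E → ℝ} (h : ChannelValid q eps) (S : Finset ι) :
    refExp q (codeMix C eps 1 S) = 1 := by
  have hc : (Nat.card C : ℝ) ≠ 0 := by exact_mod_cast Nat.card_pos.ne'
  change refExp q (fun y => (Nat.card C : ℝ)⁻¹ * ∑ x : C, 1 * likRatio eps S x y) = 1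
  simp_rw [one_mul]
  rw [refExp_const_mul, refExp_sum]
  simp_rw [refExp_likRatio h]
  rw [sum_const, card_univ, ← Nat.card_eq_fintype_card (α := C), nsmul_eq_mul, mul_one,
    inv_mul_cancel₀ hc]

/-- MAP decoding errs on the bit with the smaller posterior weight. -/
lemma codeMix_decodeBit_ne {q eps : E → ℝ} (h : ChannelValid q eps) (k : ι) (S : Finset ι)
    (y : ι → E × ZMod 2) (hy : ∏ i ∈ S, q (y i).1 / 2 ≠ 0) :
    codeMix C eps (fun x => if decodeBit C q eps k S y ≠ x k then 1 else 0) S y =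
      (codeMix C eps 1 S y - |codeMix C eps (bitSign k) S y|) / 2 := by
  have hpos : 0 < ∏ i ∈ S, q (y i).1 / 2 :=
    (prod_nonneg fun i _ => div_nonneg (h.1 _) zero_le_two).lt_of_ne' hy
  have hzero := codeMix_eq_zero C eps k S y
  have hone := codeMix_eq_one C eps k S y
  have hne0 : ∀ b : ZMod 2, 0 ≠ b ↔ b = 1 := by decide
  have hne1 : ∀ b : ZMod 2, 1 ≠ b ↔ b = 0 := by decide
  by_cases hd : post C q eps k S 1 y > post C q eps k S 0 y
  · have hlt := hd
    rw [post_eq C h, post_eq C h, gt_iff_lt, mul_lt_mul_iff_right₀ hpos] at hlt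
    simp only [decodeBit, if_pos hd, hne1]
    rw [abs_of_neg]
    · convert hzero using 1
      ring
    · linarith
  · have hle := not_lt.1 hd
    rw [post_eq C h, post_eq C h, mul_le_mul_iff_right₀ hpos] at hle
    simp only [decodeBit, if_neg hd, hne0]
    rw [abs_of_nonneg]
    · convert hone using 1
    · linarith

lemma post_flip {q eps : E → ℝ} {k : ι} {S : Finset ι} (hk : k ∉ S) (b : ZMod 2)
    (y : ι → E × ZMod 2) :
    post C q eps k S b (flipBit k y) = post C q eps k S b y := by
  have : ∀ j ∈ S, flipBit k y j = y j := fun j hj => by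
    have : j ≠ k := fun hjk => hk (hjk ▸ hj)
    simp [flipBit, this]
  unfold post
  refine sum_congr rfl fun ω _ => ?_
  congr 1
  refine propext (and_congr_right fun _ => forall₂_congr fun j hj => ?_)
  rw [this j hj]

lemma decodeBit_flip {q eps : E → ℝ} {k : ι} {S : Finset ι} (hk : k ∉ S)
    (y : ι → E × ZMod 2) :
    decodeBit C q eps k S (flipBit k y) = decodeBit C q eps k S y := by
  simp only [decodeBit, post_flip C hk]

lemma one_sub_two_mul_Ploc {q eps : E → ℝ} (h : ChannelValid q eps) (k : ι) :
    1 - 2 * Ploc C q eps k =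
      refExp q fun y => |codeMix C eps (bitSign k) (univ.erase k) y| := by
  set S := univ.erase k with hS
  have hk : k ∉ S := notMem_erase k univ
  have hins : insert k S = univ := insert_erase (mem_univ k)
  set wrong : (ι → E × ZMod 2) → (ι → ZMod 2) → ℝ :=
    fun y x => if decodeBit C q eps k S y ≠ x k then 1 else 0 with hwrong
  have hflip : ∀ x y, wrong (flipBit k y) x = wrong y x := fun x y => by
    simp only [hwrong, decodeBit_flip C hk]
  have hfull : Ploc C q eps k = (Nat.card C : ℝ)⁻¹ *
      ∑ x : C, refExp q fun y => likRatio eps univ x y * wrong y x := by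
    unfold Ploc errP jointP
    rw [Fintype.sum_prod_type, mul_sum]
    refine sum_congr rfl fun x _ => ?_
    rw [← sum_outputOf (x : ι → ZMod 2), refExp, mul_sum]
    refine sum_congr rfl fun y _ => ?_
    dsimp only
    rw [outputOf_outputOf, prod_noiseP_outputOf]
    simp only [hwrong]
    split_ifs <;> ring
  have hloc : ∀ x : C, (refExp q fun y => likRatio eps univ x y * wrong y x) =
      refExp q fun y => likRatio eps S x y * wrong y x := fun x => by
    have := refExp_add_flip q k fun y => likRatio eps univ x y * wrong y x
    simp_rw [hflip, ← add_mul, ← hins, likRatio_insert_add_flip hk, mul_assoc,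
      refExp_const_mul, hins] at this
    linarith
  have hPloc : Ploc C q eps k = refExp q fun y => codeMix C eps (wrong y) S y := by
    simp_rw [hfull, hloc, codeMix, mul_comm (likRatio _ _ _ _)]
    rw [refExp_const_mul, refExp_sum]
  have hmap : (refExp q fun y => codeMix C eps (wrong y) S y) =
      refExp q fun y => 2⁻¹ * codeMix C eps 1 S y +
        (-2⁻¹) * |codeMix C eps (bitSign k) S y| := by
    unfold refExp
    refine sum_congr rfl fun y _ => ?_
    by_cases hy : ∏ i ∈ S, q (y i).1 / 2 = 0
    · rw [← hins, prod_insert hk, hy]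
      simp
    · dsimp only [hwrong]
      rw [codeMix_decodeBit_ne C h k S y hy]
      ring
  have hone : (refExp q fun y => codeMix C eps 1 S y) = 1 := refExp_codeMix_one C h S
  rw [hPloc, hmap, refExp_add, refExp_const_mul, refExp_const_mul, hone]
  ring

lemma Ploc_nonneg [DecidableEq ι] {q eps : E → ℝ} (h : ChannelValid q eps) (k : ι) :
    0 ≤ Ploc C q eps k := by
  refine sum_nonneg fun ω _ => ?_
  split_ifs
  · refine mul_nonneg (by positivity) (prod_nonneg fun i _ => ?_)
    rw [noiseP_eq]
    exact mul_nonneg (div_nonneg (h.1 _) zero_le_two) (symbolRatio_nonneg h _)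
  · exact le_rfl

/-- The total advantage of local decoding is at least the gap to capacity. -/
lemma card_mul_capacity_sub_finrank_le [DecidableEq ι] {q eps : E → ℝ} (h : ChannelValid q eps) :
    Fintype.card ι * capacity q eps - Module.finrank (ZMod 2) C ≤
      ∑ k, (1 - 2 * Ploc C q eps k) := by
  have hcard : Real.logb 2 (Nat.card C) = Module.finrank (ZMod 2) C := by
    rw [Nat.card_eq_fintype_card, Module.card_eq_pow_finrank (K := ZMod 2), ZMod.card]
    simp [Real.logb_pow]
  rw [← hcard]
  refine ((le_outputDiv_univ C h).trans (outputDiv_le C h univ)).trans_eq ?_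
  refine sum_congr rfl fun k _ => ?_
  convert (one_sub_two_mul_Ploc C h k).symm

end LocalDecoding

open Classical in
/-- For any symmetric memoryless channel of capacity `C` and any binary linear code of rate
`R < C`, there are `Ω(n)` coordinates `j` with `P_loc,j ≤ 1/2 - Ω(1)`: there exist constants
`ε, α > 0` (depending only on the channel and `R`) such that for every length `n` and every
code of rate at most `R`, at least `α n` coordinates `j` satisfy `P_loc,j ≤ 1/2 - ε`. -/
theorem stmt4 {E : Type*} [Fintype E] (q eps : E → ℝ) (hch : ChannelValid q eps)
    (R : ℝ) (hR : R < capacity q eps) :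
    ∃ ε > (0 : ℝ), ∃ α > (0 : ℝ), ∀ (n : ℕ) (C : Submodule (ZMod 2) (Fin n → ZMod 2)),
      rate C ≤ R →
      ((univ.filter (fun j : Fin n => Ploc C q eps j ≤ 1 / 2 - ε)).card : ℝ) ≥ α * n := by
  set δ := capacity q eps - R with hδ
  have hδ0 : 0 < δ := sub_pos.2 hR
  refine ⟨δ / 4, by positivity, δ / 2, by positivity, fun n C hC => ?_⟩
  rcases Nat.eq_zero_or_pos n with rfl | hn
  · simp
  have hn' : (0 : ℝ) < n := by exact_mod_cast hn
  have hdim : (Module.finrank (ZMod 2) C : ℝ) ≤ R * n := by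
    rwa [rate, Fintype.card_fin, div_le_iff₀ hn'] at hC
  have hgap := card_mul_capacity_sub_finrank_le C hch
  rw [Fintype.card_fin] at hgap
  have hpt : ∀ j : Fin n, 1 - 2 * Ploc C q eps j ≤
      (if Ploc C q eps j ≤ 1 / 2 - δ / 4 then 1 else 0) + δ / 2 := fun j => by
    have := Ploc_nonneg C hch j
    split_ifs <;> linarith
  have hsum := sum_le_sum fun j (_ : j ∈ univ) => hpt j
  rw [sum_add_distrib, sum_boole, sum_const, card_univ, Fintype.card_fin, nsmul_eq_mul] at hsum
  have hcap : capacity q eps = δ + R := by rw [hδ]; ring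
  rw [hcap] at hgap
  linarith
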